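/- arXiv:2102.02195 — 2 statements merged into one kernel-verified Lean document; each statement's English description precedes it below -/
import Mathlib

section
/- For a generic endomorphism f of ℂⁿ (n ≥ 1): (a) the set of points of J_f whose forward orbit {f^[k](p) : k ≥ 0} is relatively compact is dense in J_f; (b) the set of points of J_f whose forward orbit is not relatively compact is dense in J_f; (c) J_f equals the topological boundary of the set of points of ℂⁿ whose forward orbit is relatively compact. (Proposition 2.16 of the paper, proved for Oka-Stein manifolds; specialized to ℂⁿ.) -/
open Function Topology Filter Metric

noncomputable section

/-- `ℂⁿ` as a Euclidean space. -/
abbrev Cn (n : ℕ) := EuclideanSpace ℂ (Fin n)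

/-- The space `End(ℂⁿ)` of holomorphic self-maps of `ℂⁿ`, topologized as a subspace of
the continuous maps `C(ℂⁿ, ℂⁿ)` with the compact-open topology. -/
abbrev Endo (n : ℕ) := {f : C(Cn n, Cn n) // Differentiable ℂ ⇑f}

variable {n : ℕ}

/-- The underlying function of an endomorphism. -/
def eapp (f : Endo n) : Cn n → Cn n := ⇑f.1

/-- `p` is a periodic point of `f`. -/
def IsPer (f : Endo n) (p : Cn n) : Prop := ∃ m, 1 ≤ m ∧ (eapp f)^[m] p = p

/-- The minimal period of a periodic point. -/
def minPer (f : Endo n) (p : Cn n) : ℕ := Function.minimalPeriod (eapp f) p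

/-- The eigenvalues at a periodic point `p`: the spectrum of the derivative of the
`minPer f p`-th iterate at `p`. -/
def eigs (f : Endo n) (p : Cn n) : Set ℂ := spectrum ℂ (fderiv ℂ ((eapp f)^[minPer f p]) p)

/-- Hyperbolic periodic point: no eigenvalue of absolute value 1. -/
def IsHypPer (f : Endo n) (p : Cn n) : Prop := IsPer f p ∧ ∀ z ∈ eigs f p, ‖z‖ ≠ 1

/-- Attracting periodic point: all eigenvalues of absolute value < 1. -/
def IsAttPer (f : Endo n) (p : Cn n) : Prop := IsPer f p ∧ ∀ z ∈ eigs f p, ‖z‖ < 1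

/-- Repelling periodic point: all eigenvalues of absolute value > 1. -/
def IsRepPer (f : Endo n) (p : Cn n) : Prop := IsPer f p ∧ ∀ z ∈ eigs f p, 1 < ‖z‖

/-- Saddle periodic point: hyperbolic with eigenvalues of absolute value both < 1 and > 1. -/
def IsSadPer (f : Endo n) (p : Cn n) : Prop :=
  IsHypPer f p ∧ (∃ z ∈ eigs f p, ‖z‖ < 1) ∧ (∃ z ∈ eigs f p, 1 < ‖z‖)

/-- Super-attracting periodic point: the derivative of the `minPer`-th iterate vanishes. -/
def IsSuperAttPer (f : Endo n) (p : Cn n) : Prop :=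
  IsPer f p ∧ fderiv ℂ ((eapp f)^[minPer f p]) p = 0

/-- The set of attracting periodic points of `f`. -/
def attSet (f : Endo n) : Set (Cn n) := {p | IsAttPer f p}

/-- The set of repelling periodic points of `f`. -/
def repSet (f : Endo n) : Set (Cn n) := {p | IsRepPer f p}

/-- The set of saddle periodic points of `f`. -/
def sadSet (f : Endo n) : Set (Cn n) := {p | IsSadPer f p}

/-- The robustly non-expelling set of `f`. -/
def rne (f : Endo n) : Set (Cn n) :=
  {p | ∃ U : Set (Cn n), IsOpen U ∧ p ∈ U ∧ ∃ V ∈ 𝓝 f, ∃ K : Set (Cn n),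
        IsCompact K ∧ ∀ g ∈ V, ∀ j : ℕ, (eapp g)^[j] '' U ⊆ K}

/-- A sequence of maps diverges locally uniformly to infinity on `U`. -/
def DivLocUnifOn (F : ℕ → Cn n → Cn n) (U : Set (Cn n)) : Prop :=
  ∀ L ⊆ U, IsCompact L → ∀ K : Set (Cn n), IsCompact K →
    ∀ᶠ j in atTop, Disjoint (F j '' L) K

/-- `p` belongs to the Fatou set of `f`: the iterates form a normal family near `p`. -/
def FatouAt (f : Endo n) (p : Cn n) : Prop :=
  ∃ U : Set (Cn n), IsOpen U ∧ p ∈ U ∧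
    ∀ k : ℕ → ℕ, StrictMono k → ∃ l : ℕ → ℕ, StrictMono l ∧
      ((∃ g : Cn n → Cn n, DifferentiableOn ℂ g U ∧
          TendstoLocallyUniformlyOn (fun j => (eapp f)^[k (l j)]) g atTop U) ∨
        DivLocUnifOn (fun j => (eapp f)^[k (l j)]) U)

/-- The Fatou set of `f`. -/
def Fatou (f : Endo n) : Set (Cn n) := {p | FatouAt f p}

/-- The Julia set of `f`. -/
def Julia (f : Endo n) : Set (Cn n) := (Fatou f)ᶜ

/-- The cycle (finite orbit) of a periodic point `p`. -/
def cycleOf (f : Endo n) (p : Cn n) : Set (Cn n) := {x | ∃ i < minPer f p, (eapp f)^[i] p = x}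

/-- The basin of attraction of the cycle of `p`. -/
def basinOf (f : Endo n) (p : Cn n) : Set (Cn n) :=
  {x | ∃ a ∈ cycleOf f p, Tendsto (fun k => (eapp f)^[minPer f p * k] x) atTop (𝓝 a)}

/-- The non-wandering set of `f`. -/
def nonWandering (f : Endo n) : Set (Cn n) :=
  {p | ∀ U ∈ 𝓝 p, ∃ k, 1 ≤ k ∧ (U ∩ (eapp f)^[k] '' U).Nonempty}

/-- The set of points whose orbit can be closed in the weak sense. -/
def cloSet (f : Endo n) : Set (Cn n) :=
  {p | ∀ U ∈ 𝓝 p, ∀ V ∈ 𝓝 f, ∃ g ∈ V, ∃ q ∈ U, IsPer g q}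

/-- `𝒯(m,K)`: endomorphisms all of whose periodic points in `K` of minimal period at most `m`
are transverse. -/
def TransSet (n : ℕ) (m : ℕ) (K : Set (Cn n)) : Set (Endo n) :=
  {f | ∀ p ∈ K, IsPer f p → minPer f p ≤ m → (1 : ℂ) ∉ eigs f p}

/-- `ℋ(m,K)`: endomorphisms all of whose periodic points in `K` of minimal period at most `m`
are hyperbolic. -/
def HypSet (n : ℕ) (m : ℕ) (K : Set (Cn n)) : Set (Endo n) :=
  {f | ∀ p ∈ K, IsPer f p → minPer f p ≤ m → ∀ z ∈ eigs f p, ‖z‖ ≠ 1}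

/-- The `m`-th iterate of an endomorphism as an endomorphism. -/
def iterEndo (f : Endo n) (m : ℕ) : Endo n :=
  ⟨⟨(eapp f)^[m], f.1.continuous.iterate m⟩, f.2.iterate m⟩

/-- The set of points with relatively compact forward orbit. -/
def boundedOrb (f : Endo n) : Set (Cn n) :=
  {p | ∃ K : Set (Cn n), IsCompact K ∧ ∀ k : ℕ, (eapp f)^[k] p ∈ K}

/-- An `ε`-chain (pseudo-orbit) of `f` from `x` to `y`. -/
def EpsChain (f : Endo n) (ε : Cn n → ℝ) (x y : Cn n) : Prop :=
  ∃ N : ℕ, 1 ≤ N ∧ ∃ c : ℕ → Cn n, c 0 = x ∧ c N = y ∧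
    ∀ j < N, dist (eapp f (c j)) (c (j + 1)) < ε (eapp f (c j))

/-- `x` and `y` are chain-equivalent for `f`. -/
def ChainEquiv (f : Endo n) (x y : Cn n) : Prop :=
  ∀ ε : Cn n → ℝ, Continuous ε → (∀ z, 0 < ε z) → EpsChain f ε x y ∧ EpsChain f ε y x

/-- `x` is chain-recurrent for `f`. -/
def ChainRec (f : Endo n) (x : Cn n) : Prop :=
  ∀ ε : Cn n → ℝ, Continuous ε → (∀ z, 0 < ε z) → EpsChain f ε x x

/-- Attracting fixed point. -/
def IsAttFix (f : Endo n) (p : Cn n) : Prop :=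
  eapp f p = p ∧ ∀ z ∈ spectrum ℂ (fderiv ℂ (eapp f) p), ‖z‖ < 1

/-- Repelling fixed point. -/
def IsRepFix (f : Endo n) (p : Cn n) : Prop :=
  eapp f p = p ∧ ∀ z ∈ spectrum ℂ (fderiv ℂ (eapp f) p), 1 < ‖z‖

/-- Saddle fixed point. -/
def IsSadFix (f : Endo n) (p : Cn n) : Prop :=
  eapp f p = p ∧ (∀ z ∈ spectrum ℂ (fderiv ℂ (eapp f) p), ‖z‖ ≠ 1) ∧
    (∃ z ∈ spectrum ℂ (fderiv ℂ (eapp f) p), ‖z‖ < 1) ∧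
    (∃ z ∈ spectrum ℂ (fderiv ℂ (eapp f) p), 1 < ‖z‖)

/-- `f` is a local biholomorphism at `p`: `f` agrees near `p` with a homeomorphism onto an
open set whose inverse is holomorphic. -/
def LocalBiholoAt (f : Endo n) (p : Cn n) : Prop :=
  ∃ φ : PartialHomeomorph (Cn n) (Cn n), p ∈ φ.source ∧ Set.EqOn (eapp f) φ φ.source ∧
    DifferentiableOn ℂ φ.symm φ.target

lemma cauchy_est {G : Cn n → Cn n} (hG : Differentiable ℂ G) {x y : Cn n} {r M : ℝ} (hr : 0 < r)
    (h : ∀ z ∈ ball x r, ‖G z - y‖ ≤ M) : ‖fderiv ℂ G x‖ ≤ 2 * M / r := by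
  refine Complex.norm_fderiv_le_div_of_mapsTo_ball hG.differentiableOn ?_ hr
  intro z hz
  rw [mem_closedBall, dist_eq_norm]
  have h1 := h z hz
  have h2 := h x (mem_ball_self hr)
  have : G z - G x = (G z - y) - (G x - y) := by abel
  rw [this]
  linarith [norm_sub_le (G z - y) (G x - y)]

/-- Holomorphy of uniform limits. -/
lemma holo_limit {F : ℕ → Cn n → Cn n} (hF : ∀ j, Differentiable ℂ (F j)) {g : Cn n → Cn n}
    {p : Cn n} {r : ℝ} (hr : 0 < r) (h : TendstoUniformlyOn F g atTop (ball p (2 * r))) :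
    DifferentiableOn ℂ g (ball p r) := by
  have hsub : ∀ x ∈ ball p r, ball x r ⊆ ball p (2 * r) := by
    intro x hx
    apply ball_subset_ball'
    rw [mem_ball] at hx
    linarith
  have hc : UniformCauchySeqOn (fun j => fderiv ℂ (F j)) atTop (ball p r) := by
    rw [Metric.uniformCauchySeqOn_iff]
    intro ε hε
    obtain ⟨N, hN⟩ := Metric.uniformCauchySeqOn_iff.1 h.uniformCauchySeqOn (ε * r / 4) (by positivity)
    refine ⟨N, fun a ha b hb x hx => ?_⟩
    have hd : fderiv ℂ (F a) x - fderiv ℂ (F b) x = fderiv ℂ (fun z => F a z - F b z) x :=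
      (fderiv_fun_sub (hF a x) (hF b x)).symm
    rw [dist_eq_norm, hd]
    have := cauchy_est (G := fun z => F a z - F b z) (x := x) (y := 0) (M := ε * r / 4)
      ((hF a).sub (hF b)) hr (by
        intro z hz
        have := hN a ha b hb z (hsub x hx hz)
        rw [dist_eq_norm] at this
        simpa using this.le)
    have h3 : 2 * (ε * r / 4) / r = ε / 2 := by field_simp; norm_num
    rw [h3] at this
    linarith
  have hlim : ∀ x, ∃ L, x ∈ ball p r → Tendsto (fun j => fderiv ℂ (F j) x) atTop (𝓝 L) := by
    intro x
    by_cases hx : x ∈ ball p r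
    · obtain ⟨L, hL⟩ := cauchySeq_tendsto_of_complete (hc.cauchySeq hx)
      exact ⟨L, fun _ => hL⟩
    · exact ⟨0, fun h => absurd h hx⟩
  choose g' hg' using hlim
  have hu := hc.tendstoUniformlyOn_of_tendsto (f := g') (fun x hx => hg' x hx)
  intro x hx
  refine (hasFDerivAt_of_tendstoUniformlyOn isOpen_ball hu (fun j z _ => (hF j z).hasFDerivAt)
    (g := g) (fun z hz => ?_) hx).differentiableAt.differentiableWithinAt
  exact h.tendsto_at (ball_subset_ball (by linarith) hz)

lemma montel {F : ℕ → Cn n → Cn n} (hF : ∀ j, Differentiable ℂ (F j)) {p : Cn n} {r M : ℝ}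
    (hr : 0 < r) (h : ∀ j, ∀ z ∈ ball p (4 * r), ‖F j z‖ ≤ M) :
    ∃ l : ℕ → ℕ, StrictMono l ∧ ∃ g : Cn n → Cn n, DifferentiableOn ℂ g (ball p r) ∧
      TendstoUniformlyOn (fun j => F (l j)) g atTop (ball p r) := by
  classical
  have hM : 0 ≤ M := (norm_nonneg _).trans (h 0 p (mem_ball_self (by linarith)))
  let X := closedBall p (2 * r)
  have : CompactSpace X := isCompact_iff_compactSpace.1 (isCompact_closedBall p (2 * r))
  let Φ : ℕ → BoundedContinuousFunction X (Cn n) := fun j =>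
    BoundedContinuousFunction.mkOfCompact ⟨fun x => F j x, (hF j).continuous.comp continuous_subtype_val⟩
  have hlip : ∀ j, ∀ x ∈ closedBall p (2 * r), ∀ y ∈ closedBall p (2 * r),
      ‖F j y - F j x‖ ≤ (2 * M / (2 * r)) * ‖y - x‖ := by
    intro j x hx y hy
    refine (convex_closedBall p (2 * r)).norm_image_sub_le_of_norm_fderiv_le (𝕜 := ℂ)
      (fun z _ => hF j z) (fun z hz => ?_) hx hy
    refine cauchy_est (y := 0) (hF j) (by linarith) (fun w hw => ?_)
    rw [sub_zero]
    refine h j w ?_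
    rw [mem_ball] at *
    rw [mem_closedBall] at hz
    linarith [dist_triangle w z p]
  have hcpt : IsCompact (closure (Set.range Φ)) := by
    refine BoundedContinuousFunction.arzela_ascoli (closedBall 0 M) (isCompact_closedBall 0 M) _ ?_ ?_
    · rintro _ x ⟨j, rfl⟩
      rw [mem_closedBall_zero_iff]
      refine h j x ?_
      have := x.2
      rw [mem_closedBall] at this
      rw [mem_ball]
      linarith
    · refine Metric.equicontinuous_of_continuity_modulus (fun t => (2 * M / (2 * r)) * t) ?_ _ ?_
      · have : Tendsto (fun t : ℝ => (2 * M / (2 * r)) * t) (𝓝 0) (𝓝 ((2 * M / (2 * r)) * 0)) :=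
          (continuous_const.mul continuous_id).tendsto 0
        simpa using this
      · rintro x y ⟨_, ⟨j, rfl⟩⟩
        have := hlip j y y.2 x x.2
        rw [dist_eq_norm, Subtype.dist_eq, dist_eq_norm]
        exact this
  obtain ⟨G, -, l, hl, hG⟩ := hcpt.tendsto_subseq (x := Φ) (fun j => subset_closure ⟨j, rfl⟩)
  let g : Cn n → Cn n := fun x => if hx : x ∈ closedBall p (2 * r) then G ⟨x, hx⟩ else 0
  have hu : TendstoUniformlyOn (fun j => F (l j)) g atTop (ball p (2 * r)) := by
    have := BoundedContinuousFunction.tendsto_iff_tendstoUniformly.1 hG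
    rw [Metric.tendstoUniformlyOn_iff]
    rw [Metric.tendstoUniformly_iff] at this
    intro ε hε
    filter_upwards [this ε hε] with j hj x hx
    have hx' : x ∈ closedBall p (2 * r) := ball_subset_closedBall hx
    have := hj ⟨x, hx'⟩
    simp only [g, dif_pos hx']
    exact this
  exact ⟨l, hl, g, holo_limit (fun j => hF (l j)) hr hu, hu.mono (ball_subset_ball (by linarith))⟩

/-- Uniform boundedness implies Fatou. -/
lemma fatou_of_bounded (f : Endo n) {U : Set (Cn n)} (hU : IsOpen U) {p : Cn n} (hp : p ∈ U)
    {M : ℝ} (h : ∀ j, ∀ z ∈ U, ‖(eapp f)^[j] z‖ ≤ M) : p ∈ Fatou f := by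
  obtain ⟨s, hs, hsU⟩ := Metric.isOpen_iff.1 hU p hp
  refine ⟨ball p (s / 4), isOpen_ball, mem_ball_self (by linarith), fun k hk => ?_⟩
  obtain ⟨l, hl, g, hg, ht⟩ := montel (F := fun j => (eapp f)^[k j]) (p := p) (r := s / 4) (M := M)
    (fun j => f.2.iterate (k j)) (by linarith) (fun j z hz => h _ z (hsU (by
      convert hz using 2; ring)))
  exact ⟨l, hl, Or.inl ⟨g, hg, ht.tendstoLocallyUniformlyOn⟩⟩

lemma isOpen_Fatou (f : Endo n) : IsOpen (Fatou f) := by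
  rw [isOpen_iff_forall_mem_open]
  rintro p ⟨U, hU, hp, h⟩
  exact ⟨U, fun q hq => ⟨U, hU, hq, h⟩, hU, hp⟩

/-- A (strongly) repelling periodic point. -/
def SRep (f : Endo n) (k : ℕ) (q : Cn n) : Prop :=
  1 ≤ k ∧ (eapp f)^[k] q = q ∧
    ‖fderiv ℂ ((eapp f)^[k]) q - (2 : ℂ) • ContinuousLinearMap.id ℂ (Cn n)‖ ≤ 1 / 2

lemma SRep.julia (hn : 1 ≤ n) {f : Endo n} {k : ℕ} {q : Cn n} (h : SRep f k q) : q ∈ Julia f := by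
  obtain ⟨hk, hq, hD⟩ := h
  rintro ⟨U, hU, hqU, hF⟩
  set F := (eapp f)^[k] with hFdef
  have hFd : Differentiable ℂ F := f.2.iterate k
  set A := fderiv ℂ F q with hA
  have hexp : ∀ v, (3 / 2 : ℝ) * ‖v‖ ≤ ‖A v‖ := by
    intro v
    have h1 := ContinuousLinearMap.le_of_opNorm_le _ hD v
    have h2 : (A - (2 : ℂ) • ContinuousLinearMap.id ℂ (Cn n)) v = A v - (2 : ℂ) • v := by simp
    rw [h2] at h1
    have h3 : ‖(2 : ℂ) • v‖ = 2 * ‖v‖ := by rw [norm_smul]; simp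
    have h4 := norm_sub_norm_le ((2 : ℂ) • v) (A v)
    rw [norm_sub_rev] at h4
    linarith
  have hder : ∀ m : ℕ, HasFDerivAt (F^[m]) (A ^ m) q := by
    intro m
    exact (hFd q).hasFDerivAt.iterate hq m
  have hpow : ∀ m : ℕ, ∀ v, (3 / 2 : ℝ) ^ m * ‖v‖ ≤ ‖(A ^ m) v‖ := by
    intro m
    induction m with
    | zero => intro v; simp
    | succ m ih =>
      intro v
      rw [pow_succ' A, mul_apply_eq_comp]
      refine le_trans ?_ (hexp _)
      rw [pow_succ']
      have := ih v
      nlinarith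
  obtain ⟨l, hl, hcase⟩ := hF (fun j => k * j) (fun a b hab => Nat.mul_lt_mul_of_pos_left hab hk)
  have hit : ∀ m, (eapp f)^[k * m] = F^[m] := fun m => Function.iterate_mul _ _ _
  have hfix : ∀ m, F^[m] q = q := fun m => Function.iterate_fixed hq m
  rcases hcase with ⟨g, hg, ht⟩ | hdiv
  · have hgc : ContinuousAt g q := (hg.differentiableAt (hU.mem_nhds hqU)).continuousAt
    rw [Metric.tendstoLocallyUniformlyOn_iff] at ht
    obtain ⟨t, ht1, ht2⟩ := ht 1 one_pos q hqU
    rw [hU.nhdsWithin_eq hqU] at ht1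
    have hgb : ∀ᶠ x in 𝓝 q, dist (g x) (g q) < 1 := Metric.tendsto_nhds.1 hgc 1 one_pos
    obtain ⟨r, hr, hrs⟩ := Metric.mem_nhds_iff.1 (Filter.inter_mem ht1 hgb)
    have hbig : ∀ᶠ j in atTop, (4 / r) < (3 / 2 : ℝ) ^ (l j) :=
      ((tendsto_pow_atTop_atTop_of_one_lt (by norm_num : (1:ℝ) < 3 / 2)).comp
        hl.tendsto_atTop).eventually_gt_atTop _
    obtain ⟨j, hj1, hj2⟩ := (ht2.and hbig).exists
    have hb := cauchy_est (G := F^[l j]) (x := q) (y := g q) (r := r) (M := 2)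
      (hFd.iterate (l j)) hr (by
        intro z hz
        obtain ⟨hz1, hz2⟩ := hrs hz
        have h1 := hj1 z hz1
        rw [hit] at h1
        have h2 : dist (g z) (g q) < 1 := hz2
        rw [← dist_eq_norm]
        rw [dist_comm] at h1
        linarith [dist_triangle (F^[l j] z) (g z) (g q)])
    rw [(hder (l j)).fderiv] at hb
    have : Nonempty (Fin n) := ⟨⟨0, hn⟩⟩
    obtain ⟨v, hv⟩ := exists_ne (0 : Cn n)
    have hv' : 0 < ‖v‖ := norm_pos_iff.2 hv
    have h1 := ContinuousLinearMap.le_of_opNorm_le _ hb v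
    have h2 := hpow (l j) v
    have h3 : (4 / r) * ‖v‖ < (3 / 2 : ℝ) ^ (l j) * ‖v‖ := by gcongr
    have h4 : 2 * 2 / r = 4 / r := by norm_num
    rw [h4] at h1
    linarith
  · have := hdiv {q} (Set.singleton_subset_iff.2 hqU) isCompact_singleton {q} isCompact_singleton
    obtain ⟨j, hj⟩ := this.exists
    beta_reduce at hj
    rw [hit, Set.image_singleton, hfix] at hj
    simp at hj

/-- Maps with a strongly repelling periodic point in `U` whose orbit leaves the ball of radius `m`. -/
def OO (U : Set (Cn n)) (m : ℝ) : Set (Endo n) :=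
  {g | ∃ k q, q ∈ U ∧ SRep g k q ∧ ∃ j, m < ‖(eapp g)^[j] q‖}

lemma continuous_iterEndo (k : ℕ) : Continuous (fun g : Endo n => (iterEndo g k).1) := by
  induction k with
  | zero =>
    have : (fun g : Endo n => (iterEndo g 0).1) = fun _ => ContinuousMap.id _ := by
      funext g; ext x; rfl
    rw [this]; exact continuous_const
  | succ k ih =>
    have : (fun g : Endo n => (iterEndo g (k + 1)).1) = fun g => (iterEndo g k).1.comp g.1 := by
      funext g; ext x; rfl
    rw [this]
    exact ih.compCM continuous_subtype_val

lemma eventually_close (g : Endo n) (k : ℕ) {K : Set (Cn n)} (hK : IsCompact K) {δ : ℝ} (hδ : 0 < δ) :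
    ∀ᶠ g' in 𝓝 g, ∀ x ∈ K, dist ((eapp g)^[k] x) ((eapp g')^[k] x) < δ := by
  have h := (continuous_iterEndo (n := n) k).tendsto g
  rw [ContinuousMap.tendsto_iff_forall_isCompact_tendstoUniformlyOn] at h
  exact Metric.tendstoUniformlyOn_iff.1 (h K hK) δ hδ

lemma persist {g : Endo n} {U : Set (Cn n)} (hU : IsOpen U) {q : Cn n} (hq : q ∈ U) {k j : ℕ} {m : ℝ}
    (hk : 1 ≤ k) (hfix : (eapp g)^[k] q = q)
    (hD : HasFDerivAt ((eapp g)^[k]) ((2 : ℂ) • ContinuousLinearMap.id ℂ (Cn n)) q)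
    (hm : m < ‖(eapp g)^[j] q‖) : OO U m ∈ 𝓝 g := by
  have hT : HasFDerivAt (fun x => (2 : ℂ) • x - (eapp g)^[k] x) (0 : Cn n →L[ℂ] Cn n) q := by
    have := ((hasFDerivAt_id (𝕜 := ℂ) q).const_smul (2 : ℂ)).sub hD
    rw [sub_self] at this
    exact this
  have hlo := (hasFDerivAt_iff_isLittleO.1 hT).def (c := 1 / 16) (by norm_num)
  set δ := (‖(eapp g)^[j] q‖ - m) / 2 with hδ
  have hδ0 : 0 < δ := by rw [hδ]; linarith
  have hcj : ∀ᶠ x in 𝓝 q, m + δ < ‖(eapp g)^[j] x‖ :=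
    ((g.1.continuous.iterate j).norm.continuousAt (x := q)).eventually_const_lt
      (by change m + δ < ‖(eapp g)^[j] q‖; rw [hδ]; linarith)
  obtain ⟨s, hs, hsub⟩ := Metric.mem_nhds_iff.1 (Filter.inter_mem (Filter.inter_mem hlo hcj) (hU.mem_nhds hq))
  set r := s / 3 with hr
  have hr0 : 0 < r := by positivity
  have hKs : closedBall q (2 * r) ⊆ ball q s := closedBall_subset_ball (by linarith)
  filter_upwards [eventually_close g k (isCompact_closedBall q (2 * r)) (δ := r / 8) (by positivity),
    eventually_close g j (isCompact_closedBall q (2 * r)) hδ0] with g' h1 h2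
  set T' : Cn n → Cn n := fun x => (2 : ℂ) • x - (eapp g')^[k] x with hT'
  have hgd : Differentiable ℂ ((eapp g')^[k]) := g'.2.iterate k
  have hT'd : Differentiable ℂ T' := (differentiable_id.const_smul (2 : ℂ)).sub hgd
  have hT'b : ∀ x ∈ closedBall q (2 * r), ‖T' x - q‖ ≤ r / 4 := by
    intro x hx
    have e1 := (hsub (hKs hx)).1.1
    simp only [Set.mem_ofPred_eq, hfix, zero_apply, sub_zero] at e1
    have e2 := h1 x hx
    rw [dist_eq_norm] at e2
    have e3 : T' x - q = ((2 : ℂ) • x - (eapp g)^[k] x - ((2 : ℂ) • q - q))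
        + ((eapp g)^[k] x - (eapp g')^[k] x) := by
      simp only [hT', two_smul]; abel
    rw [e3]
    rw [mem_closedBall, dist_eq_norm] at hx
    refine (norm_add_le _ _).trans ?_
    linarith
  have hder : ∀ x ∈ closedBall q r, ‖fderiv ℂ T' x‖ ≤ 1 / 2 := by
    intro x hx
    have := cauchy_est (y := q) (M := r / 4) hT'd (x := x) hr0 (fun z hz => hT'b z (by
      rw [mem_ball] at hz; rw [mem_closedBall] at *; linarith [dist_triangle z x q]))
    refine this.trans (le_of_eq ?_)
    field_simp; norm_num
  have hmaps : Set.MapsTo T' (closedBall q r) (closedBall q r) := by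
    intro x hx
    rw [mem_closedBall, dist_eq_norm]
    linarith [hT'b x (closedBall_subset_closedBall (by linarith) hx)]
  have hlip : LipschitzOnWith (1 / 2) T' (closedBall q r) := by
    refine LipschitzOnWith.of_dist_le_mul (fun x hx y hy => ?_)
    rw [dist_eq_norm, dist_eq_norm]
    have := (convex_closedBall q r).norm_image_sub_le_of_norm_fderiv_le (𝕜 := ℂ)
      (fun z _ => hT'd z) hder hy hx
    simpa using this
  have hcontr : ContractingWith (1 / 2) (hmaps.restrict T' (closedBall q r) (closedBall q r)) :=
    ⟨by rw [← NNReal.coe_lt_coe]; norm_num, hlip.mapsToRestrict hmaps⟩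
  obtain ⟨y, hy, hyf, -⟩ := hcontr.exists_fixedPoint' isClosed_closedBall.isComplete hmaps
    (mem_closedBall_self hr0.le) (edist_ne_top _ _)
  have hy2 : y ∈ closedBall q (2 * r) := closedBall_subset_closedBall (by linarith) hy
  have hys := hsub (hKs hy2)
  refine ⟨k, y, hys.2, ⟨hk, ?_, ?_⟩, j, ?_⟩
  · have : (2 : ℂ) • y - (eapp g')^[k] y = y := hyf
    rw [two_smul, sub_eq_iff_eq_add] at this
    exact (add_left_cancel this).symm
  · have h4 : HasFDerivAt T' ((2 : ℂ) • ContinuousLinearMap.id ℂ (Cn n) - fderiv ℂ ((eapp g')^[k]) y) y :=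
      ((hasFDerivAt_id (𝕜 := ℂ) y).const_smul (2 : ℂ)).sub (hgd y).hasFDerivAt
    have h5 := hder y hy
    rw [h4.fderiv] at h5
    rw [norm_sub_rev]; exact h5
  · have h6 := h2 y hy2
    rw [dist_eq_norm] at h6
    have h7 : m + δ < ‖(eapp g)^[j] y‖ := hys.1.2
    linarith [norm_sub_norm_le ((eapp g)^[j] y) ((eapp g')^[j] y)]

def pp (t : ℂ) : ℂ := t ^ 2 * (2 - t ^ 2)

lemma pp_diff : Differentiable ℂ pp := by unfold pp; fun_prop

lemma pp_zero : pp 0 = 0 := by simp [pp]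
lemma pp_one : pp 1 = 1 := by norm_num [pp]

lemma pp_deriv (t : ℂ) : HasDerivAt pp (4 * t - 4 * t ^ 3) t := by
  have h1 := (hasDerivAt_pow 2 t)
  have h2 := h1.mul (h1.const_sub 2)
  convert! h2 using 1
  norm_num; ring

lemma pp_comp {ℓ : Cn n → ℂ} (hℓ : Differentiable ℂ ℓ) {x : Cn n} (h : ℓ x = 0 ∨ ℓ x = 1) :
    HasFDerivAt (fun z => pp (ℓ z)) (0 : Cn n →L[ℂ] ℂ) x := by
  have h1 := (pp_deriv (ℓ x)).comp_hasFDerivAt x (hℓ x).hasFDerivAt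
  have h2 : 4 * ℓ x - 4 * ℓ x ^ 3 = 0 := by rcases h with h | h <;> rw [h] <;> norm_num
  rw [h2] at h1
  convert! h1 using 1
  ext v; simp

lemma pp_bound {t : ℂ} (h : ‖t‖ ≤ 1) : ‖pp t‖ ≤ 3 * ‖t‖ := by
  have h0 := norm_nonneg t
  have h1 : ‖2 - t ^ 2‖ ≤ 3 := by
    refine (norm_sub_le _ _).trans ?_
    rw [norm_pow]
    have : ‖(2 : ℂ)‖ = 2 := by simp
    nlinarith
  rw [pp, norm_mul, norm_pow]
  have : ‖t‖ ^ 2 ≤ ‖t‖ := by nlinarith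
  nlinarith [norm_nonneg (2 - t ^ 2)]

/-- normalized linear functional -/
def lam (v : Cn n) (z : Cn n) : ℂ := innerSL ℂ v z / (‖v‖ : ℂ) ^ 2

lemma lam_diff (v : Cn n) : Differentiable ℂ (lam v) := by
  unfold lam
  have h : Differentiable ℂ (fun z => innerSL ℂ v z) := (innerSL ℂ v).differentiable
  simp only [div_eq_mul_inv]
  exact h.mul_const _

lemma lam_self {v : Cn n} (hv : v ≠ 0) : lam v v = 1 := by
  unfold lam
  rw [innerSL_apply_apply, inner_self_eq_norm_sq_to_K]
  have : (‖v‖ : ℂ) ≠ 0 := by simpa using hv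
  exact div_self (pow_ne_zero 2 this)

lemma lam_zero {v : Cn n} : lam v 0 = 0 := by simp [lam]

lemma lam_bound {v : Cn n} (hv : v ≠ 0) (z : Cn n) : ‖lam v z‖ ≤ ‖z‖ / ‖v‖ := by
  have hv' : 0 < ‖v‖ := norm_pos_iff.2 hv
  unfold lam
  rw [innerSL_apply_apply, norm_div, norm_pow, Complex.norm_real, norm_norm, div_le_div_iff₀ (by positivity) hv']
  have := norm_inner_le_norm (𝕜 := ℂ) v z
  nlinarith

lemma bump (S : Finset (Cn n)) (x : Cn n) (hx : x ∉ S) : ∃ χ : Cn n → ℂ, Differentiable ℂ χ ∧ χ x = 1 ∧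
    HasFDerivAt χ (0 : Cn n →L[ℂ] ℂ) x ∧ ∀ y ∈ S, χ y = 0 ∧ HasFDerivAt χ (0 : Cn n →L[ℂ] ℂ) y := by
  classical
  induction S using Finset.induction_on with
  | empty => exact ⟨fun _ => 1, differentiable_const _, rfl, hasFDerivAt_const _ _, by simp⟩
  | insert y S hy ih =>
    rw [Finset.mem_insert, not_or] at hx
    obtain ⟨χ, hd, h1, h2, h3⟩ := ih hx.2
    have hv : x - y ≠ 0 := sub_ne_zero.2 hx.1
    set ℓ : Cn n → ℂ := fun z => lam (x - y) (z - y) with hℓ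
    have hℓd : Differentiable ℂ ℓ := (lam_diff _).comp (differentiable_id.sub_const y)
    have hℓx : ℓ x = 1 := lam_self hv
    have hℓy : ℓ y = 0 := by simp [hℓ, lam_zero]
    have hpd : Differentiable ℂ (fun z => pp (ℓ z)) := pp_diff.comp hℓd
    refine ⟨fun z => pp (ℓ z) * χ z, hpd.mul hd, ?_, ?_, ?_⟩
    · simp [hℓx, pp_one, h1]
    · have := (pp_comp hℓd (Or.inr hℓx)).mul h2
      convert! this using 1
      ext v; simp
    · intro w hw
      rcases Finset.mem_insert.1 hw with rfl | hw
      · refine ⟨by simp [hℓy, pp_zero], ?_⟩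
        have := (pp_comp hℓd (Or.inl hℓy)).mul (hd w).hasFDerivAt
        convert! this using 1
        ext v; simp [hℓy, pp_zero]
      · refine ⟨by simp [(h3 w hw).1], ?_⟩
        have := (hpd w).hasFDerivAt.mul (h3 w hw).2
        convert! this using 1
        ext v; simp [(h3 w hw).1]

lemma equiv_of_inj (T : Cn n →L[ℂ] Cn n) (h : Function.Injective T) :
    ∃ e : Cn n ≃L[ℂ] Cn n, (e : Cn n →L[ℂ] Cn n) = T := by
  refine ⟨(LinearEquiv.ofInjectiveEndo T.toLinearMap h).toContinuousLinearEquiv, ?_⟩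
  ext x; rfl

lemma eventually_inj (T : Cn n →L[ℂ] Cn n) :
    ∀ᶠ ε in 𝓝[≠] (0 : ℂ), Function.Injective ⇑(T + ε • ContinuousLinearMap.id ℂ (Cn n)) := by
  have hfin := Module.End.finite_hasEigenvalue (T.toLinearMap : Module.End ℂ (Cn n))
  have hfin2 : ({ε : ℂ | Module.End.HasEigenvalue (T.toLinearMap : Module.End ℂ (Cn n)) (-ε)}).Finite :=
    hfin.preimage neg_injective.injOn
  filter_upwards [nhdsNE_le_cofinite _ hfin2.compl_mem_cofinite] with ε hε
  rw [injective_iff_map_eq_zero]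
  intro v hv
  by_contra hne
  refine hε (Module.End.hasEigenvalue_of_hasEigenvector (x := v) ⟨?_, hne⟩)
  rw [Module.End.mem_eigenspace_iff]
  simp only [add_apply, smul_apply, ContinuousLinearMap.id_apply] at hv
  rw [neg_smul]
  exact eq_neg_of_add_eq_zero_left hv

lemma chain_iter {g : Cn n → Cn n} {x : ℕ → Cn n} {D E : ℕ → (Cn n ≃L[ℂ] Cn n)} {j : ℕ}
    (hE0 : E 0 = ContinuousLinearEquiv.refl ℂ (Cn n)) (hE : ∀ i, E (i + 1) = (E i).trans (D i))
    (h : ∀ i < j, g (x i) = x (i + 1) ∧ HasFDerivAt g (D i : Cn n →L[ℂ] Cn n) (x i)) :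
    ∀ i ≤ j, g^[i] (x 0) = x i ∧ HasFDerivAt (g^[i]) (E i : Cn n →L[ℂ] Cn n) (x 0) := by
  intro i
  induction i with
  | zero => 
    intro _
    rw [hE0]
    exact ⟨rfl, hasFDerivAt_id _⟩
  | succ i ih =>
    intro hi
    obtain ⟨h1, h2⟩ := ih (by omega)
    obtain ⟨h3, h4⟩ := h i (by omega)
    rw [Function.iterate_succ', hE]
    refine ⟨by rw [Function.comp_apply, h1, h3], ?_⟩
    rw [← h1] at h4
    exact h4.comp (x 0) h2

lemma perturb (f : Endo n) {R ε₀ : ℝ} (hR : 0 ≤ R) (hε₀ : 0 < ε₀) {q : Cn n} {a : ℕ}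
    (ha : R < ‖(eapp f)^[a] q‖) :
    ∃ g : Endo n, (∀ z ∈ closedBall (0 : Cn n) R, dist (eapp f z) (eapp g z) < ε₀) ∧
      ∃ k j, 1 ≤ k ∧ (eapp g)^[k] q = q ∧
        HasFDerivAt ((eapp g)^[k]) ((2 : ℂ) • ContinuousLinearMap.id ℂ (Cn n)) q ∧
        R < ‖(eapp g)^[j] q‖ := by
  classical
  have hex : ∃ a, R < ‖(eapp f)^[a] q‖ := ⟨a, ha⟩
  set j := Nat.find hex with hj
  have hjR : R < ‖(eapp f)^[j] q‖ := Nat.find_spec hex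
  have hjmin : ∀ i < j, ‖(eapp f)^[i] q‖ ≤ R := fun i hi => not_lt.1 (Nat.find_min hex hi)
  clear_value j
  set x : ℕ → Cn n := fun i => (eapp f)^[i] q with hx
  have hxs : ∀ i, eapp f (x i) = x (i + 1) := fun i => (Function.iterate_succ_apply' _ _ _).symm
  have hfd : Differentiable ℂ (eapp f) := f.2
  -- distinctness
  have hinj' : ∀ b ≤ j, ∀ c < b, x c ≠ x b := by
    intro b hb c hc heq
    have hsh : ∀ t, x (c + t) = x (b + t) := by
      intro t
      induction t with
      | zero => exact heq
      | succ t ih => rw [← add_assoc, ← add_assoc, ← hxs, ← hxs, ih]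
    have h1 := hsh (j - b)
    rw [Nat.add_sub_cancel' hb] at h1
    have h2 := hjmin (c + (j - b)) (by omega)
    have h3 : ‖x (c + (j - b))‖ ≤ R := h2
    rw [h1] at h3
    exact absurd hjR (not_lt.2 h3)
  have hinj : ∀ b ≤ j, ∀ c ≤ j, c ≠ b → x c ≠ x b := by
    intro b hb c hc hne
    rcases lt_or_gt_of_ne hne with h | h
    · exact hinj' b hb c h
    · exact (hinj' c hc b h).symm
  -- bumps
  have hbump : ∀ i, ∃ χ : Cn n → ℂ, Differentiable ℂ χ ∧ (i ≤ j → χ (x i) = 1 ∧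
      (∀ k ≤ j, k ≠ i → χ (x k) = 0) ∧ ∀ k ≤ j, HasFDerivAt χ (0 : Cn n →L[ℂ] ℂ) (x k)) := by
    intro i
    by_cases hi : i ≤ j
    · obtain ⟨χ, h1, h2, h3, h4⟩ := bump (((Finset.range (j + 1)).erase i).image x) (x i) (by
        rw [Finset.mem_image]
        rintro ⟨k, hk, hk2⟩
        rw [Finset.mem_erase, Finset.mem_range] at hk
        exact hinj i hi k (by omega) hk.1 hk2)
      have hmem : ∀ k ≤ j, k ≠ i → x k ∈ ((Finset.range (j + 1)).erase i).image x := by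
        intro k hk hki
        exact Finset.mem_image_of_mem _ (Finset.mem_erase.2 ⟨hki, Finset.mem_range.2 (by omega)⟩)
      refine ⟨χ, h1, fun _ => ⟨h2, fun k hk hki => (h4 _ (hmem k hk hki)).1, fun k hk => ?_⟩⟩
      by_cases hki : k = i
      · rw [hki]; exact h3
      · exact (h4 _ (hmem k hk hki)).2
    · exact ⟨fun _ => 0, differentiable_const _, fun h => absurd h hi⟩
  choose χ hχd hχ using hbump
  -- the polynomial P
  set P : Cn n → Cn n := fun z => ∑ i ∈ Finset.range (j + 1), χ i z • (z - x i) with hP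
  have hPd : Differentiable ℂ P := by
    intro z
    refine DifferentiableAt.fun_sum (fun i _ => ?_)
    exact (hχd i z).smul (differentiableAt_id.sub_const _)
  have hP0 : ∀ k ≤ j, P (x k) = 0 := by
    intro k hk
    refine Finset.sum_eq_zero (fun i hi => ?_)
    by_cases hik : k = i
    · rw [hik, sub_self, smul_zero]
    · rw [(hχ i (by have := Finset.mem_range.1 hi; omega)).2.1 k hk hik, zero_smul]
  have hPD : ∀ k ≤ j, HasFDerivAt P (ContinuousLinearMap.id ℂ (Cn n)) (x k) := by
    intro k hk
    have h1 : HasFDerivAt P (∑ i ∈ Finset.range (j + 1),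
        (if i = k then ContinuousLinearMap.id ℂ (Cn n) else 0)) (x k) := by
      refine HasFDerivAt.fun_sum (fun i hi => ?_)
      have hi' : i ≤ j := by have := Finset.mem_range.1 hi; omega
      have h2 := ((hχ i hi').2.2 k hk).smul ((hasFDerivAt_id (𝕜 := ℂ) (x k)).sub_const (x i))
      convert! h2 using 1
      by_cases hik : i = k
      · subst hik
        ext v : 1
        simp [(hχ i hi').1]
      · ext v : 1
        simp [(hχ i hi').2.1 k hk (Ne.symm hik), hik]
    rw [Finset.sum_ite_eq' (Finset.range (j + 1)) k, if_pos (Finset.mem_range.2 (by omega))] at h1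
    exact h1
  -- bound for P
  obtain ⟨C, hC⟩ := (isCompact_closedBall (0 : Cn n) R).exists_bound_of_continuousOn hPd.continuous.continuousOn
  -- choose ε
  have hev1 : ∀ᶠ ε in 𝓝[≠] (0 : ℂ), ∀ k ∈ Finset.range (j + 1),
      Function.Injective ⇑(fderiv ℂ (eapp f) (x k) + ε • ContinuousLinearMap.id ℂ (Cn n)) :=
    (Filter.eventually_all_finset _).2 (fun k _ => eventually_inj _)
  have hev2 : ∀ᶠ ε in 𝓝[≠] (0 : ℂ), ‖ε‖ * (|C| + 1) < ε₀ / 2 := by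
    have : Tendsto (fun ε : ℂ => ‖ε‖ * (|C| + 1)) (𝓝[≠] 0) (𝓝 (‖(0 : ℂ)‖ * (|C| + 1))) :=
      ((continuous_norm.mul continuous_const).tendsto 0).mono_left nhdsWithin_le_nhds
    rw [norm_zero, zero_mul] at this
    exact this.eventually_lt_const (by positivity)
  obtain ⟨ε, hε1, hε2⟩ := (hev1.and hev2).exists
  have hDex : ∀ k, ∃ e : Cn n ≃L[ℂ] Cn n, k ≤ j →
      (e : Cn n →L[ℂ] Cn n) = fderiv ℂ (eapp f) (x k) + ε • ContinuousLinearMap.id ℂ (Cn n) := by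
    intro k
    by_cases hk : k ≤ j
    · obtain ⟨e, he⟩ := equiv_of_inj _ (hε1 k (Finset.mem_range.2 (by omega)))
      exact ⟨e, fun _ => he⟩
    · exact ⟨ContinuousLinearEquiv.refl ℂ _, fun h => absurd h hk⟩
  choose D hD using hDex
  set E : ℕ → (Cn n ≃L[ℂ] Cn n) :=
    fun i => Nat.rec (ContinuousLinearEquiv.refl ℂ (Cn n)) (fun i e => e.trans (D i)) i with hE
  -- f1
  set f1 : Cn n → Cn n := fun z => eapp f z + ε • P z with hf1
  have hf1d : Differentiable ℂ f1 := hfd.add (hPd.const_smul ε)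
  have hf1v : ∀ k ≤ j, f1 (x k) = x (k + 1) := by
    intro k hk
    simp only [hf1, hP0 k hk, smul_zero, add_zero, hxs]
  have hf1D : ∀ k ≤ j, HasFDerivAt f1 (D k : Cn n →L[ℂ] Cn n) (x k) := by
    intro k hk
    rw [hD k hk]
    exact (hfd (x k)).hasFDerivAt.add ((hPD k hk).const_smul ε)
  -- correction
  set A : Cn n →L[ℂ] Cn n := (2 : ℂ) • ((E j).symm : Cn n →L[ℂ] Cn n) with hA
  set M : Cn n →L[ℂ] Cn n := A - (D j : Cn n →L[ℂ] Cn n) with hM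
  set c : Cn n := q - x (j + 1) with hc
  set Q : Cn n → Cn n := fun z => c + M (z - x j) with hQ
  have hQd : Differentiable ℂ Q := (M.differentiable.comp (differentiable_id.sub_const _)).const_add c
  have hQD : ∀ z, HasFDerivAt Q M z := by
    intro z
    have := (M.hasFDerivAt.comp z ((hasFDerivAt_id (𝕜 := ℂ) z).sub_const (x j))).const_add c
    exact this
  have hQ2d : Differentiable ℂ (fun z => χ j z • Q z) := (hχd j).smul hQd
  obtain ⟨C2, hC2⟩ := (isCompact_closedBall (0 : Cn n) R).exists_bound_of_continuousOn
    hQ2d.continuous.continuousOn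
  have hz0 : x j ≠ 0 := by
    intro h
    have : R < ‖x j‖ := hjR
    rw [h, norm_zero] at this
    linarith
  have hz0' : 0 < ‖x j‖ := norm_pos_iff.2 hz0
  set θ := R / ‖x j‖ with hθ
  have hθ0 : 0 ≤ θ := by positivity
  have hθ1 : θ < 1 := (div_lt_one hz0').2 hjR
  obtain ⟨N, hN⟩ : ∃ N : ℕ, 3 * θ ^ N * (|C2| + 1) < ε₀ / 2 := by
    have : Tendsto (fun N : ℕ => 3 * θ ^ N * (|C2| + 1)) atTop (𝓝 (3 * 0 * (|C2| + 1))) :=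
      ((tendsto_pow_atTop_nhds_zero_of_lt_one hθ0 hθ1).const_mul 3).mul_const _
    rw [mul_zero, zero_mul] at this
    exact (this.eventually_lt_const (by positivity)).exists
  set μ : Cn n → ℂ := fun z => lam (x j) z ^ N with hμ
  have hμd : Differentiable ℂ μ := (lam_diff (x j)).pow N
  have hμ1 : μ (x j) = 1 := by simp [hμ, lam_self hz0]
  have hpμd : Differentiable ℂ (fun z => pp (μ z)) := pp_diff.comp hμd
  set h : Cn n → Cn n := fun z => pp (μ z) • (χ j z • Q z) with hh
  have hhd : Differentiable ℂ h := hpμd.smul hQ2d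
  obtain ⟨hχ1, hχ0, hχD⟩ := hχ j le_rfl
  have hhv : h (x j) = c := by simp [hh, hμ1, pp_one, hχ1, hQ]
  have hhv0 : ∀ k < j, h (x k) = 0 := by
    intro k hk
    simp [hh, hχ0 k hk.le hk.ne]
  have hχQ : ∀ k ≤ j, HasFDerivAt (fun z => χ j z • Q z) (χ j (x k) • M) (x k) := by
    intro k hk
    convert! (hχD k hk).smul (hQD (x k)) using 1
    ext v : 1
    simp
  have hhD : HasFDerivAt h M (x j) := by
    convert! (pp_comp hμd (Or.inr hμ1)).smul (hχQ j le_rfl) using 1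
    ext v : 1
    simp [hμ1, pp_one, hχ1]
  have hhD0 : ∀ k < j, HasFDerivAt h (0 : Cn n →L[ℂ] Cn n) (x k) := by
    intro k hk
    convert! (hpμd (x k)).hasFDerivAt.smul (hχQ k hk.le) using 1
    ext v : 1
    simp [hχ0 k hk.le hk.ne]
  -- the perturbed map
  set G : Cn n → Cn n := fun z => f1 z + h z with hG
  have hGd : Differentiable ℂ G := hf1d.add hhd
  have hGch := chain_iter (g := G) (x := x) (D := D) (E := E) (j := j) rfl (fun i => rfl) (by
    intro i hi
    refine ⟨by simp [hG, hf1v i hi.le, hhv0 i hi], ?_⟩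
    have := (hf1D i hi.le).add (hhD0 i hi)
    rw [add_zero] at this
    exact this)
  obtain ⟨hGj, hGjD⟩ := hGch j le_rfl
  have hGlast : HasFDerivAt G A (x j) := by
    have := (hf1D j le_rfl).add hhD
    rw [hM, add_sub_cancel] at this
    exact this
  refine ⟨⟨⟨G, hGd.continuous⟩, hGd⟩, ?_, j + 1, j, by omega, ?_, ?_, ?_⟩
  · intro z hz
    change dist (eapp f z) (eapp f z + ε • P z + h z) < ε₀
    rw [dist_eq_norm]
    have e1 : eapp f z - (eapp f z + ε • P z + h z) = -(ε • P z + h z) := by abel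
    rw [e1, norm_neg]
    have e2 : ‖ε • P z‖ ≤ ‖ε‖ * (|C| + 1) := by
      rw [norm_smul]
      have := hC z hz
      gcongr
      linarith [le_abs_self C]
    have hzR : ‖z‖ ≤ R := by simpa using hz
    have e3 : ‖μ z‖ ≤ θ ^ N := by
      rw [hμ]
      simp only [norm_pow]
      gcongr
      exact (lam_bound hz0 z).trans (by rw [hθ]; gcongr)
    have e4 : ‖pp (μ z)‖ ≤ 3 * θ ^ N :=
      (pp_bound (e3.trans (pow_le_one₀ hθ0 hθ1.le))).trans (by linarith)
    have e5 : ‖h z‖ ≤ 3 * θ ^ N * (|C2| + 1) := by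
      rw [hh]
      simp only
      rw [norm_smul]
      have := hC2 z hz
      gcongr
      linarith [le_abs_self C2]
    linarith [norm_add_le (ε • P z) (h z)]
  · change G^[j + 1] (x 0) = x 0
    rw [Function.iterate_succ_apply', hGj]
    simp only [hG, hf1v j le_rfl, hhv, hc]
    change x (j + 1) + (q - x (j + 1)) = q
    abel
  · change HasFDerivAt (G^[j + 1]) _ (x 0)
    rw [Function.iterate_succ']
    rw [← hGj] at hGlast
    convert! hGlast.comp (x 0) hGjD using 1
    ext v : 1
    simp [hA]
  · change R < ‖G^[j] (x 0)‖
    rw [hGj]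
    exact hjR

lemma mem_closure_OO (f : Endo n) {U : Set (Cn n)} (hU : IsOpen U) (m : ℝ)
    (h : ∀ R : ℝ, ∃ q ∈ U, ∃ a, R < ‖(eapp f)^[a] q‖) : f ∈ closure (interior (OO U m)) := by
  rw [mem_closure_iff_nhds]
  intro V hV
  obtain ⟨W, hW, hWV⟩ := (mem_nhds_subtype _ f V).1 hV
  obtain ⟨X, hX, hXW⟩ := UniformSpace.mem_nhds_iff.1 hW
  obtain ⟨⟨K, ε⟩, ⟨hK, hε⟩, hKX⟩ :=
    (Metric.uniformity_basis_dist (α := Cn n)).compactConvergenceUniformity.mem_iff.1 hX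
  obtain ⟨R, hR⟩ := hK.isBounded.subset_closedBall (0 : Cn n)
  obtain ⟨q, hq, a, ha⟩ := h (max (max R m) 0)
  obtain ⟨g, hg, k, j, hk, hfix, hD, hj⟩ := perturb f (le_max_right _ _) hε ha
  refine ⟨g, hWV (hXW (hKX fun z hz => ?_)), mem_interior_iff_mem_nhds.2 (persist hU hq hk hfix hD
    (((le_max_right _ _).trans (le_max_left _ _)).trans_lt hj))⟩
  exact hg z (closedBall_subset_closedBall ((le_max_left _ _).trans (le_max_left _ _)) (hR hz))

lemma residual_dichotomy {X : Type*} [TopologicalSpace X] {G : Set X} (hG : IsOpen G) :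
    ∀ᶠ f in residual X, f ∈ closure G → f ∈ G := by
  have h1 : IsOpen (frontier G)ᶜ := isClosed_frontier.isOpen_compl
  have h2 : Dense (frontier G)ᶜ := interior_eq_empty_iff_dense_compl.1 (by
    rw [← frontier_compl]; exact interior_frontier hG.isClosed_compl)
  filter_upwards [residual_of_dense_open h1 h2] with f hf hc
  by_contra hn
  exact hf (by rw [hG.frontier_eq]; exact ⟨hc, hn⟩)

lemma bounded_iff (f : Endo n) (p : Cn n) :
    p ∈ boundedOrb f ↔ ∃ M : ℝ, ∀ k, ‖(eapp f)^[k] p‖ ≤ M := by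
  constructor
  · rintro ⟨K, hK, h⟩
    obtain ⟨R, hR⟩ := hK.isBounded.subset_closedBall (0 : Cn n)
    exact ⟨R, fun k => by simpa using hR (h k)⟩
  · rintro ⟨M, h⟩
    exact ⟨closedBall 0 M, isCompact_closedBall _ _, fun k => by simpa using h k⟩

lemma SRep.bounded {f : Endo n} {k : ℕ} {q : Cn n} (h : SRep f k q) : q ∈ boundedOrb f := by
  obtain ⟨hk, hq, -⟩ := h
  refine ⟨(fun i => (eapp f)^[i] q) '' (Finset.range k : Set ℕ),
    ((Finset.finite_toSet _).image _).isCompact, fun i => ?_⟩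
  refine ⟨i % k, by simpa using Nat.mod_lt _ hk, ?_⟩
  exact Function.IsPeriodicPt.iterate_mod_apply (f := eapp f) hq i


/-- For a generic endomorphism `f` of `ℂⁿ`: points of `J_f` with relatively compact orbit are
dense in `J_f`, points of `J_f` with non-relatively-compact orbit are dense in `J_f`, and
`J_f` is the boundary of the set of points with relatively compact orbit. -/
theorem stmt_15 (n : ℕ) (hn : 1 ≤ n) :
    {f : Endo n | Julia f ⊆ closure (Julia f ∩ boundedOrb f) ∧
      Julia f ⊆ closure (Julia f \ boundedOrb f) ∧
      Julia f = frontier (boundedOrb f)} ∈ residual (Endo n) := by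
  have hB := TopologicalSpace.isBasis_countableBasis (Cn n)
  have hcount := TopologicalSpace.countable_countableBasis (Cn n)
  have hres : ∀ᶠ f in residual (Endo n), ∀ U ∈ TopologicalSpace.countableBasis (Cn n), ∀ m : ℕ,
      f ∈ closure (interior (OO U (m : ℝ))) → f ∈ interior (OO U (m : ℝ)) := by
    rw [eventually_countable_ball hcount]
    intro U _
    rw [eventually_countable_forall]
    intro m
    exact residual_dichotomy isOpen_interior
  filter_upwards [hres] with f hf
  have hJc : IsClosed (Julia f) := (isOpen_Fatou f).isClosed_compl
  -- key property
  have key : ∀ U ∈ TopologicalSpace.countableBasis (Cn n),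
      (∀ R : ℝ, ∃ q ∈ U, ∃ a, R < ‖(eapp f)^[a] q‖) → ∀ m : ℕ,
      ∃ q ∈ U, q ∈ Julia f ∧ q ∈ boundedOrb f ∧ ∃ j, (m : ℝ) < ‖(eapp f)^[j] q‖ := by
    intro U hU h m
    obtain ⟨k, q, hq, hs, hj⟩ := interior_subset (hf U hU m (mem_closure_OO f (hB.isOpen hU) m h))
    exact ⟨q, hq, hs.julia hn, hs.bounded, hj⟩
  have unb : ∀ U ∈ TopologicalSpace.countableBasis (Cn n), ∀ p ∈ U, p ∈ Julia f →
      ∀ R : ℝ, ∃ q ∈ U, ∃ a, R < ‖(eapp f)^[a] q‖ := by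
    intro U hU p hp hpJ R
    by_contra hcon
    push Not at hcon
    exact hpJ (fatou_of_bounded f (hB.isOpen hU) hp (fun j z hz => hcon z hz j))
  have ha : Julia f ⊆ closure (Julia f ∩ boundedOrb f) := by
    intro p hp
    rw [hB.mem_closure_iff]
    intro U hU hpU
    obtain ⟨q, hq, h1, h2, -⟩ := key U hU (unb U hU p hpU hp) 0
    exact ⟨q, hq, h1, h2⟩
  have hb : Julia f ⊆ closure (Julia f \ boundedOrb f) := by
    have : CompleteSpace (Julia f) := hJc.completeSpace_coe
    let S : ℕ → Set (Julia f) := fun m => {p | ∃ j, (m : ℝ) < ‖(eapp f)^[j] p.1‖}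
    have hSo : ∀ m, IsOpen (S m) := by
      intro m
      have : S m = ⋃ j, {p : Julia f | (m : ℝ) < ‖(eapp f)^[j] p.1‖} := by
        ext p; simp [S]
      rw [this]
      refine isOpen_iUnion (fun j => isOpen_lt continuous_const ?_)
      exact ((f.1.continuous.iterate j).comp continuous_subtype_val).norm
    have hSd : ∀ m, Dense (S m) := by
      intro m p
      rw [_root_.mem_closure_iff]
      intro O hO hpO
      obtain ⟨O', hO', rfl⟩ := isOpen_induced_iff.1 hO
      obtain ⟨U, hU, hpU, hUO⟩ := hB.exists_subset_of_mem_open hpO hO'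
      obtain ⟨q, hq, h1, -, h3⟩ := key U hU (unb U hU p hpU p.2) m
      exact ⟨⟨q, h1⟩, hUO hq, h3⟩
    have hd := dense_iInter_of_isOpen hSo hSd
    intro p hp
    rw [_root_.mem_closure_iff]
    intro O hO hpO
    obtain ⟨q, hq, hqS⟩ := hd.inter_open_nonempty (Subtype.val ⁻¹' O) (hO.preimage continuous_subtype_val)
      ⟨⟨p, hp⟩, hpO⟩
    refine ⟨q, hq, q.2, fun hqB => ?_⟩
    obtain ⟨M, hM⟩ := (bounded_iff f q).1 hqB
    obtain ⟨m, hm⟩ := exists_nat_ge M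
    obtain ⟨j, hj⟩ := Set.mem_iInter.1 hqS m
    linarith [hM j]
  refine ⟨ha, hb, Set.Subset.antisymm ?_ ?_⟩
  · intro p hp
    rw [frontier_eq_closure_inter_closure]
    exact ⟨closure_mono Set.inter_subset_right (ha hp), closure_mono (fun x hx => hx.2) (hb hp)⟩
  · intro p hp
    by_contra hpJ
    by_cases hall : ∀ U ∈ TopologicalSpace.countableBasis (Cn n), p ∈ U →
        ∀ R : ℝ, ∃ q ∈ U, ∃ a, R < ‖(eapp f)^[a] q‖
    · refine hpJ (hJc.closure_subset ?_)
      rw [hB.mem_closure_iff]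
      intro U hU hpU
      obtain ⟨q, hq, h1, -⟩ := key U hU (hall U hU hpU) 0
      exact ⟨q, hq, h1⟩
    · push Not at hall
      obtain ⟨U, hU, hpU, R, hR⟩ := hall
      refine hp.2 (mem_interior.2 ⟨U, fun q hq => ?_, hB.isOpen hU, hpU⟩)
      exact (bounded_iff f q).2 ⟨R, fun k => hR q hq k⟩
end
end

section
/- Let n ≥ 1, let f ∈ End(ℂⁿ), and let p ∈ ℂⁿ \ rne(f). For every neighbourhood U of p in ℂⁿ and every neighbourhood V of f in End(ℂⁿ), there exist g ∈ V and q ∈ U such that q is an escaping point of g, i.e., the sequence (g^[k](q))_{k≥0} eventually leaves every compact subset of ℂⁿ (tends to infinity). (Proposition 2.18 of the paper, proved for Oka-Stein manifolds; specialized to ℂⁿ.) -/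
open Function Topology Filter Metric

noncomputable section

variable {n : ℕ}

lemma aux_term {E : Type*} [NormedAddCommGroup E] [NormedSpace ℂ E]
    (r : ℝ) (hr0 : 0 ≤ r) (hr : r < 1) (F : Finset ℂ) (hF : ∀ x ∈ F, ‖x‖ ≤ r)
    (v : E) (k : ℕ) (ε : ℝ) (hε : 0 < ε) :
    ∃ c : ℂ → E, Differentiable ℂ c ∧ (∀ x ∈ F, c x = 0) ∧ c ((k : ℂ) + 1) = v ∧
      (∀ m : ℕ, m ≠ k → c ((m : ℂ) + 1) = 0) ∧ ∀ z : ℂ, ‖z‖ ≤ k + r → ‖c z‖ ≤ ε := by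
  set a : ℂ := (k : ℂ) + 1 with ha
  have ha0 : a ≠ 0 := Nat.cast_add_one_ne_zero k
  have hna : ‖a‖ = k + 1 := by
    rw [ha, ← Nat.cast_add_one, Complex.norm_natCast]; push_cast; ring
  let S : ℂ → ℂ := fun z => Complex.sin (Real.pi * z)
  have hSd : Differentiable ℂ S := by fun_prop
  have hS0 : ∀ m : ℕ, S ((m : ℂ) + 1) = 0 := by
    intro m
    have := Complex.sin_nat_mul_pi (m + 1)
    simp only [S]
    rw [mul_comm]
    exact_mod_cast this
  let G : ℂ → ℂ := dslope S a
  have hGd : Differentiable ℂ G := by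
    rw [← differentiableOn_univ]
    exact (Complex.differentiableOn_dslope univ_mem).2 hSd.differentiableOn
  have hG0 : ∀ m : ℕ, m ≠ k → G ((m : ℂ) + 1) = 0 := by
    intro m hm
    have hne : (m : ℂ) + 1 ≠ a := by
      rw [ha]; intro h; apply hm; exact_mod_cast add_right_cancel h
    simp only [G]
    rw [dslope_of_ne _ hne, slope_def_field, hS0 m, ha, hS0 k]
    simp
  have hGa : G a ≠ 0 := by
    simp only [G]
    rw [dslope_same]
    have hd : HasDerivAt S (Complex.cos (Real.pi * a) * (Real.pi * 1)) a :=
      ((hasDerivAt_id a).const_mul (Real.pi : ℂ)).csin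
    rw [hd.deriv]
    intro h
    rcases mul_eq_zero.1 h with h | h
    · have h1 := Complex.sin_sq_add_cos_sq (Real.pi * a)
      have h2 : Complex.sin (Real.pi * a) = 0 := hS0 k
      rw [h, h2] at h1
      simp at h1
    · simp [Real.pi_ne_zero] at h
  let P : ℂ → ℂ := fun z => ∏ x ∈ F, (z - x)
  have hPd : Differentiable ℂ P := by
    simp only [P]; fun_prop
  have hPa : P a ≠ 0 := by
    simp only [P]
    rw [Finset.prod_ne_zero_iff]
    intro x hx h
    have h1 := hF x hx
    rw [← sub_eq_zero.1 h, hna] at h1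
    have : (0 : ℝ) ≤ k := Nat.cast_nonneg k
    linarith
  let B : ℂ → E := fun z => (P z * G z / (P a * G a)) • v
  have hBd : Differentiable ℂ B := by
    simp only [B]
    exact ((hPd.mul hGd).div_const _).smul_const v
  obtain ⟨M, hM⟩ := (isCompact_closedBall (0 : ℂ) (k + r)).exists_bound_of_continuousOn
    hBd.continuous.continuousOn
  have hk : (0 : ℝ) ≤ k := Nat.cast_nonneg k
  have hM0 : 0 ≤ M := (norm_nonneg _).trans (hM 0 (by simp; linarith))
  have hq0 : 0 ≤ ((k : ℝ) + r) / (k + 1) := by positivity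
  have hq1 : ((k : ℝ) + r) / (k + 1) < 1 := by
    rw [div_lt_one (by linarith)]; linarith
  obtain ⟨N, hN⟩ := exists_pow_lt_of_lt_one (show 0 < ε / (M + 1) by positivity) hq1
  refine ⟨fun z => (z / a) ^ N • B z, ?_, ?_, ?_, ?_, ?_⟩
  · exact ((differentiable_id.div_const a).pow N).smul hBd
  · intro x hx
    have : P x = 0 := Finset.prod_eq_zero hx (sub_self x)
    simp [B, this]
  · simp only [B]
    rw [div_self ha0, div_self (mul_ne_zero hPa hGa)]
    simp
  · intro m hm
    simp [B, hG0 m hm]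
  · intro z hz
    have h1 := hM z (by simpa using hz)
    rw [norm_smul, norm_pow, norm_div, hna]
    have h2 : (‖z‖ / ((k : ℝ) + 1)) ^ N ≤ (((k : ℝ) + r) / (k + 1)) ^ N := by gcongr
    calc _ ≤ ε / (M + 1) * M := mul_le_mul (h2.trans hN.le) h1 (norm_nonneg _) (by positivity)
      _ ≤ ε := by
        rw [div_mul_eq_mul_div, div_le_iff₀ (by positivity)]
        nlinarith

lemma aux_interp {E : Type*} [NormedAddCommGroup E] [NormedSpace ℂ E] [CompleteSpace E]
    (r : ℝ) (hr0 : 0 ≤ r) (hr : r < 1) (F : Finset ℂ) (hF : ∀ x ∈ F, ‖x‖ ≤ r)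
    (v : ℕ → E) (ε : ℝ) (hε : 0 < ε) :
    ∃ c : ℂ → E, Differentiable ℂ c ∧ (∀ x ∈ F, c x = 0) ∧
      (∀ m : ℕ, c ((m : ℂ) + 1) = v m) ∧ ∀ z : ℂ, ‖z‖ ≤ r → ‖c z‖ ≤ ε := by
  choose c hcd hcF hcv hc0 hcb using fun k : ℕ =>
    aux_term r hr0 hr F hF (v k) k (ε / 2 / 2 ^ k) (by positivity)
  have hsum : HasSum (fun k : ℕ => ε / 2 / 2 ^ k) ε := hasSum_geometric_two' ε
  refine ⟨fun z => ∑' k, c k z, ?_, ?_, ?_, ?_⟩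
  · intro z
    obtain ⟨m, hm⟩ := exists_nat_gt ‖z‖
    choose C hC using fun k => (isCompact_closedBall (0 : ℂ) m).exists_bound_of_continuousOn
      (hcd k).continuous.continuousOn
    have hC0 : ∀ k, 0 ≤ C k := fun k => (norm_nonneg _).trans (hC k 0 (by simp))
    have hu : Summable (fun k : ℕ => ε / 2 / 2 ^ k + if k < m then C k else 0) := by
      refine hsum.summable.add (summable_of_ne_finset_zero (s := Finset.range m) ?_)
      intro b hb
      rw [if_neg (by simpa using hb)]
    have := Complex.differentiableOn_tsum_of_summable_norm (F := c) (U := ball (0 : ℂ) m) hu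
      (fun i => (hcd i).differentiableOn) isOpen_ball ?_
    · exact this.differentiableAt (isOpen_ball.mem_nhds (by simpa using hm))
    · intro i w hw
      have hw' : ‖w‖ < m := by simpa using hw
      split_ifs with h
      · have := hC i w (ball_subset_closedBall hw)
        have : 0 < ε / 2 / 2 ^ i := by positivity
        linarith
      · rw [add_zero]
        apply hcb
        have : (m : ℝ) ≤ i := by exact_mod_cast not_lt.1 h
        linarith
  · intro x hx
    simp [hcF _ x hx]
  · intro m
    dsimp only
    rw [tsum_eq_single m (fun k hk => hc0 k m hk.symm), hcv]
  · intro z hz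
    refine tsum_of_norm_bounded hsum fun k => hcb k z ?_
    have : (0 : ℝ) ≤ k := Nat.cast_nonneg k
    linarith

lemma aux_nhds_sub (f : Endo n) (V : Set (Endo n)) (hV : V ∈ 𝓝 f) :
    ∃ R : ℝ, 0 ≤ R ∧ ∃ ε : ℝ, 0 < ε ∧
      ∀ g : Endo n, (∀ x, ‖x‖ ≤ R → dist (eapp f x) (eapp g x) < ε) → g ∈ V := by
  rw [nhds_subtype_eq_comap, mem_comap] at hV
  obtain ⟨W, hW, hWV⟩ := hV
  obtain ⟨⟨K, ε⟩, ⟨hK, hε⟩, hsub⟩ := (nhds_basis_uniformity'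
    (uniformity_basis_dist.compactConvergenceUniformity (α := Cn n)) (x := f.1)).mem_iff.1 hW
  obtain ⟨R, hR⟩ := hK.isBounded.exists_norm_le
  refine ⟨max R 0, le_max_right _ _, ε, hε, fun g hg => hWV (hsub ?_)⟩
  intro x hx
  exact hg x ((hR x hx).trans (le_max_left _ _))

lemma aux_mem_nhds (f : Endo n) (R ε : ℝ) (hε : 0 < ε) :
    {g : Endo n | ∀ x, ‖x‖ ≤ R → dist (eapp f x) (eapp g x) < ε} ∈ 𝓝 f := by
  rw [nhds_subtype_eq_comap, mem_comap]
  refine ⟨_, (nhds_basis_uniformity'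
    (uniformity_basis_dist.compactConvergenceUniformity (α := Cn n)) (x := f.1)).mem_of_mem
    (i := (closedBall (0 : Cn n) R, ε)) ⟨isCompact_closedBall _ _, hε⟩, ?_⟩
  intro g hg x hx
  exact hg x (by simpa using hx)

/-- Near any point outside `rne(f)` an arbitrarily small perturbation of `f` has an escaping
point. -/
theorem stmt_17 (n : ℕ) (hn : 1 ≤ n) (f : Endo n) (p : Cn n) (hp : p ∉ rne f)
    (U : Set (Cn n)) (hU : U ∈ 𝓝 p) (V : Set (Endo n)) (hV : V ∈ 𝓝 f) :
    ∃ g ∈ V, ∃ q ∈ U, ∀ K : Set (Cn n), IsCompact K →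
      ∀ᶠ k in atTop, (eapp g)^[k] q ∉ K := by
  obtain ⟨R, hR0, ε, hε, hsub⟩ := aux_nhds_sub f V hV
  have hV' := aux_mem_nhds f R (ε / 2) (by positivity)
  have hex : ∃ g : Endo n, (∀ x, ‖x‖ ≤ R → dist (eapp f x) (eapp g x) < ε / 2) ∧
      ∃ q ∈ U, ∃ j : ℕ, R < ‖(eapp g)^[j] q‖ := by
    by_contra hcon
    push Not at hcon
    apply hp
    refine ⟨interior U, isOpen_interior, mem_interior_iff_mem_nhds.2 hU, _, hV',
      closedBall 0 R, isCompact_closedBall _ _, ?_⟩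
    rintro g hg j _ ⟨q, hq, rfl⟩
    simpa using hcon g hg q (interior_subset hq) j
  obtain ⟨g, hg, q, hqU, hj⟩ := hex
  classical
  obtain ⟨j, hj1, hj2⟩ : ∃ j, R < ‖(eapp g)^[j] q‖ ∧ ∀ i < j, ‖(eapp g)^[i] q‖ ≤ R :=
    ⟨Nat.find hj, Nat.find_spec hj, fun i hi => not_lt.1 (Nat.find_min hj hi)⟩
  set a : Cn n := (eapp g)^[j] q with ha
  have hapos : 0 < ‖a‖ := hR0.trans_lt hj1
  have ha0 : a ≠ 0 := norm_pos_iff.1 hapos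
  let l : Cn n →L[ℂ] ℂ := ((‖a‖ : ℂ) ^ 2)⁻¹ • innerSL ℂ a
  have hla : l a = 1 := by
    have : (‖a‖ : ℂ) ≠ 0 := by exact_mod_cast hapos.ne'
    simp [l, inner_self_eq_norm_sq_to_K, this]
  have hlb : ∀ x, ‖x‖ ≤ R → ‖l x‖ ≤ R / ‖a‖ := by
    intro x hx
    have h1 : ‖inner ℂ a x‖ ≤ ‖a‖ * ‖x‖ := norm_inner_le_norm a x
    have h2 : ‖l x‖ = (‖a‖ ^ 2)⁻¹ * ‖inner ℂ a x‖ := by simp [l]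
    rw [h2]
    calc _ ≤ (‖a‖ ^ 2)⁻¹ * (‖a‖ * R) := by gcongr; exact h1.trans (by gcongr)
      _ = R / ‖a‖ := by field_simp
  obtain ⟨c, hcd, hcF, hcv, hcb⟩ := aux_interp (E := Cn n) (R / ‖a‖) (by positivity)
    ((div_lt_one hapos).2 hj1)
    ((Finset.range j).image fun i => l ((eapp g)^[i] q))
    (by
      intro x hx
      simp only [Finset.mem_image, Finset.mem_range] at hx
      obtain ⟨i, hi, rfl⟩ := hx
      exact hlb _ (hj2 i hi))
    (fun k => ((k : ℂ) + 1 + 1) • a - eapp g (((k : ℂ) + 1) • a)) (ε / 2) (by positivity)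
  have hhd : Differentiable ℂ (fun z => eapp g z + c (l z)) :=
    Differentiable.add g.2 (hcd.comp l.differentiable)
  let h : Endo n := ⟨⟨fun z => eapp g z + c (l z), hhd.continuous⟩, hhd⟩
  have hh : ∀ z, eapp h z = eapp g z + c (l z) := fun z => rfl
  have hit1 : ∀ i ≤ j, (eapp h)^[i] q = (eapp g)^[i] q := by
    intro i
    induction i with
    | zero => intro _; rfl
    | succ i ih =>
      intro hi
      rw [iterate_succ_apply', iterate_succ_apply', ih (by omega), hh, hcF, add_zero]
      exact Finset.mem_image_of_mem (fun i => l ((eapp g)^[i] q)) (Finset.mem_range.2 hi)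
  have hit2 : ∀ k : ℕ, (eapp h)^[k + j] q = ((k : ℂ) + 1) • a := by
    intro k
    induction k with
    | zero => simp [hit1 j le_rfl, ha]
    | succ k ih =>
      have e : k + 1 + j = (k + j) + 1 := by omega
      rw [e, iterate_succ_apply', ih, hh, map_smul, hla, smul_eq_mul, mul_one, hcv]
      push_cast
      abel
  refine ⟨h, hsub h ?_, q, hqU, ?_⟩
  · intro x hx
    have h1 := hg x hx
    have h2 := hcb (l x) (hlb x hx)
    have h3 : dist (eapp g x) (eapp h x) = ‖c (l x)‖ := by
      rw [hh, dist_self_add_right]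
    linarith [dist_triangle (eapp f x) (eapp g x) (eapp h x)]
  · intro K hK
    obtain ⟨C, hC⟩ := hK.isBounded.exists_norm_le
    obtain ⟨m, hm⟩ := exists_nat_gt (C / ‖a‖)
    filter_upwards [eventually_ge_atTop (m + j)] with k hk hkK
    obtain ⟨i, rfl⟩ : ∃ i, k = i + j := ⟨k - j, by omega⟩
    have h1 := hC _ hkK
    rw [hit2, norm_smul, ← Nat.cast_add_one, Complex.norm_natCast] at h1
    have hmi : (m : ℝ) ≤ i := by exact_mod_cast (by omega : m ≤ i)
    rw [div_lt_iff₀ hapos] at hm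
    push_cast at h1
    nlinarith
end
end
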